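/- The space ℓ₁ does not contain a subspace linearly isometric to c; that is, there is no linear isometric embedding of c into ℓ₁. -/

import Mathlib

open Filter Topology ENNReal

noncomputable section

abbrev ellInfty : Type := ↥(lp (fun _ : ℕ => ℝ) ∞)

def cSub : Submodule ℝ ellInfty where
  carrier := {x | ∃ l : ℝ, Tendsto (fun i => (x : ℕ → ℝ) i) atTop (𝓝 l)}
  add_mem' := by
    rintro x y ⟨l, hl⟩ ⟨m, hm⟩
    refine ⟨l + m, (hl.add hm).congr fun i => ?_⟩
    simp [lp.coeFn_add]
  zero_mem' := ⟨0, by simp [lp.coeFn_zero, tendsto_const_nhds]⟩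
  smul_mem' := by
    rintro a x ⟨l, hl⟩
    refine ⟨a * l, ((hl.const_mul a)).congr fun i => ?_⟩
    simp [lp.coeFn_smul]

abbrev cSpace : Type := ↥cSub

/-- The constant sequence `(1,1,1,…)` as an element of `c`. -/
def onesC : cSpace :=
  ⟨⟨(fun _ => 1 : ∀ _ : ℕ, ℝ), memℓp_infty ⟨1, by rintro r ⟨i, rfl⟩; simp⟩⟩,
    ⟨1, tendsto_const_nhds⟩⟩

/-- The sequence whose `n`-th coordinate is `-1` and all other coordinates are `1`,
as an element of `c`. -/
def flipC (n : ℕ) : cSpace :=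
  ⟨⟨(fun i => if i = n then -1 else 1 : ∀ _ : ℕ, ℝ),
      memℓp_infty ⟨1, by rintro r ⟨i, rfl⟩; by_cases h : i = n <;> simp [h]⟩⟩,
    ⟨1, tendsto_const_nhds.congr' (by
      filter_upwards [eventually_gt_atTop n] with i hi
      simp [Nat.ne_of_gt hi])⟩⟩


abbrev ellOne : Type := ↥(lp (fun _ : ℕ => ℝ) 1)

/-- Hlawka's inequality for real numbers, in symmetrised form. -/
lemma two_mul_abs_add_abs_add_abs_le (a b c : ℝ) :
    2 * (|a| + |b| + |c|) ≤ |a + b + c| + |-a + b + c| + |a - b + c| + |a + b - c| := by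
  have h₁ := abs_le.mp (le_refl |a + b + c|)
  have h₂ := abs_le.mp (le_refl |-a + b + c|)
  have h₃ := abs_le.mp (le_refl |a - b + c|)
  have h₄ := abs_le.mp (le_refl |a + b - c|)
  rcases abs_cases a with ⟨ha, _⟩ | ⟨ha, _⟩ <;> rcases abs_cases b with ⟨hb, _⟩ | ⟨hb, _⟩ <;>
    rcases abs_cases c with ⟨hc, _⟩ | ⟨hc, _⟩ <;> rw [ha, hb, hc] <;> linarith

lemma ellOne_hasSum_abs (x : ellOne) : HasSum (fun i => |(x : ℕ → ℝ) i|) ‖x‖ := by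
  simpa using lp.hasSum_norm (p := 1) (by simp) x

/-- Hlawka's inequality in `ℓ₁`, in symmetrised form. -/
lemma ellOne_two_mul_norm_add_norm_add_norm_le (x y z : ellOne) :
    2 * (‖x‖ + ‖y‖ + ‖z‖) ≤ ‖x + y + z‖ + ‖-x + y + z‖ + ‖x - y + z‖ + ‖x + y - z‖ :=
  hasSum_le
    (fun i =>
      two_mul_abs_add_abs_add_abs_le ((x : ℕ → ℝ) i) ((y : ℕ → ℝ) i) ((z : ℕ → ℝ) i))
    ((((ellOne_hasSum_abs x).add (ellOne_hasSum_abs y)).add (ellOne_hasSum_abs z)).mul_left 2)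
    ((((ellOne_hasSum_abs (x + y + z)).add (ellOne_hasSum_abs (-x + y + z))).add
      (ellOne_hasSum_abs (x - y + z))).add (ellOne_hasSum_abs (x + y - z)))

lemma cSpace_norm_le {x : cSpace} {C : ℝ} (hC : 0 ≤ C)
    (h : ∀ i, |((x : ellInfty) : ℕ → ℝ) i| ≤ C) : ‖x‖ ≤ C :=
  lp.norm_le_of_forall_le hC h

lemma le_cSpace_norm (x : cSpace) (i : ℕ) : |((x : ellInfty) : ℕ → ℝ) i| ≤ ‖x‖ :=
  lp.norm_apply_le_norm (p := ∞) (by simp) (x : ellInfty) i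

/-- Twice the `n`-th unit vector of `c`. -/
def twoUnitC (n : ℕ) : cSpace := onesC - flipC n

lemma twoUnitC_apply (n i : ℕ) :
    ((twoUnitC n : ellInfty) : ℕ → ℝ) i = if i = n then 2 else 0 := by
  change (1 : ℝ) - (if i = n then -1 else 1) = _
  split_ifs <;> norm_num

lemma two_le_norm_twoUnitC (n : ℕ) : 2 ≤ ‖twoUnitC n‖ := by
  simpa [twoUnitC_apply] using le_cSpace_norm (twoUnitC n) n

lemma norm_twoUnitC_combination_le {a b c : ℝ} (ha : |a| ≤ 1) (hb : |b| ≤ 1) (hc : |c| ≤ 1) :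
    ‖a • twoUnitC 0 + b • twoUnitC 1 + c • twoUnitC 2‖ ≤ 2 := by
  refine cSpace_norm_le zero_le_two fun i => ?_
  change |a * ((twoUnitC 0 : ellInfty) : ℕ → ℝ) i + b * ((twoUnitC 1 : ellInfty) : ℕ → ℝ) i +
    c * ((twoUnitC 2 : ellInfty) : ℕ → ℝ) i| ≤ 2
  simp only [twoUnitC_apply]
  rw [abs_le] at *
  split_ifs <;> first | omega | constructor <;> linarith

/-- `ℓ₁` contains no subspace linearly isometric to `c`: there is no
linear isometric embedding of `c` into `ℓ₁`. -/
theorem statement15 : IsEmpty (cSpace →ₗᵢ[ℝ] ellOne) := by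
  refine ⟨fun T => ?_⟩
  have hlawka := ellOne_two_mul_norm_add_norm_add_norm_le
    (T (twoUnitC 0)) (T (twoUnitC 1)) (T (twoUnitC 2))
  simp only [← map_neg, ← map_add, ← map_sub, T.norm_map] at hlawka
  have hppp := norm_twoUnitC_combination_le (a := 1) (b := 1) (c := 1)
    (by simp) (by simp) (by simp)
  have hnpp := norm_twoUnitC_combination_le (a := -1) (b := 1) (c := 1)
    (by simp) (by simp) (by simp)
  have hpnp := norm_twoUnitC_combination_le (a := 1) (b := -1) (c := 1)
    (by simp) (by simp) (by simp)
  have hppn := norm_twoUnitC_combination_le (a := 1) (b := 1) (c := -1)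
    (by simp) (by simp) (by simp)
  simp only [one_smul, neg_smul, ← sub_eq_add_neg] at hppp hnpp hpnp hppn
  linarith [two_le_norm_twoUnitC 0, two_le_norm_twoUnitC 1, two_le_norm_twoUnitC 2]
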